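/- P_G satisfies the diamond condition: (i) every rank-1 face ({a},v) of P_G lies above exactly two rank-0 faces, namely (∅,v) and (∅,w), where w is the unique vertex joined to v by the edge of color a at v; and (ii) whenever F = (C,v) and H = (D,v) are faces of P_G with C ⊆ D and |D| = |C| + 2, there are exactly two faces K of P_G with F < K < H. -/

import Mathlib

open SimpleGraph

variable {V R : Type*}

/-- The spanning subgraph of `G` keeping only the edges whose color lies in `C`. -/
def colorSub (G : SimpleGraph V) (c : V → V → R) (C : Finset R) : SimpleGraph V :=
  SimpleGraph.fromRel (fun a b => G.Adj a b ∧ c a b ∈ C)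

/-- `v` and `w` are `C`-equivalent: joined by a walk all of whose edges have colors in `C`. -/
def cEquiv (G : SimpleGraph V) (c : V → V → R) (C : Finset R) (v w : V) : Prop :=
  (colorSub G c C).Reachable v w

/-- `c` is a proper edge coloring of `G` such that at each vertex the colors of the incident
edges are pairwise distinct and exhaust the color set `R`
(so `G` is a properly edge-colored `|R|`-regular graph). -/
structure IsProperColoring (G : SimpleGraph V) (c : V → V → R) : Prop where
  symm : ∀ v w, G.Adj v w → c v w = c w v
  bijOn : ∀ v : V, Set.BijOn (fun w => c v w) (G.neighborSet v) Set.univ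

/-- The preorder on pairs `(C, v)`. -/
def faceLE (G : SimpleGraph V) (c : V → V → R) (p q : Finset R × V) : Prop :=
  p.1 ⊆ q.1 ∧ cEquiv G c q.1 p.2 q.2

/-- The identification `(C,v) = (D,w)` iff `C = D` and `v ∼_C w`. -/
def faceSetoid (G : SimpleGraph V) (c : V → V → R) : Setoid (Finset R × V) where
  r p q := p.1 = q.1 ∧ cEquiv G c p.1 p.2 q.2
  iseqv := by
    constructor
    · exact fun p => ⟨rfl, SimpleGraph.Reachable.refl _⟩
    · rintro p q ⟨h1, h2⟩
      refine ⟨h1.symm, ?_⟩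
      rw [← h1]
      exact h2.symm
    · rintro p q u ⟨h1, h2⟩ ⟨h3, h4⟩
      refine ⟨h1.trans h3, h2.trans ?_⟩
      rw [h1]
      exact h4

lemma colorSub_mono (G : SimpleGraph V) (c : V → V → R) {C D : Finset R} (h : C ⊆ D) :
    colorSub G c C ≤ colorSub G c D := by
  intro a b hab
  obtain ⟨hne, h'⟩ := hab
  exact ⟨hne, h'.imp (fun hx => ⟨hx.1, h hx.2⟩) (fun hx => ⟨hx.1, h hx.2⟩)⟩

lemma cEquiv_mono (G : SimpleGraph V) (c : V → V → R) {C D : Finset R} (h : C ⊆ D)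
    {v w : V} (hvw : cEquiv G c C v w) : cEquiv G c D v w :=
  hvw.mono (colorSub_mono G c h)

/-- The faces of the colorful polytope `P_G`. -/
def ColorfulFace (G : SimpleGraph V) (c : V → V → R) : Type _ :=
  Quotient (faceSetoid G c)

/-- The face of `P_G` represented by the pair `(C, v)`. -/
def mkFace (G : SimpleGraph V) (c : V → V → R) (C : Finset R) (v : V) : ColorfulFace G c :=
  Quotient.mk (faceSetoid G c) (C, v)

/-- The partial order of the colorful polytope `P_G`. -/
instance ColorfulFace.instPartialOrder (G : SimpleGraph V) (c : V → V → R) :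
    PartialOrder (ColorfulFace G c) where
  le := Quotient.lift₂ (faceLE G c) (by
    rintro p q p' q' ⟨hp1, hp2⟩ ⟨hq1, hq2⟩
    ext
    constructor
    · rintro ⟨hsub, hreach⟩
      constructor
      · rw [← hp1, ← hq1]; exact hsub
      · rw [← hq1]
        have h1 : cEquiv G c q.1 p'.2 p.2 := cEquiv_mono G c hsub (hp1 ▸ hp2.symm)
        exact (h1.trans hreach).trans hq2
    · rintro ⟨hsub, hreach⟩
      constructor
      · rw [hp1, hq1]; exact hsub
      · rw [hq1]
        have h2 : cEquiv G c q'.1 p.2 p'.2 := by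
          refine cEquiv_mono G c ?_ hp2
          rw [hp1]; exact hsub
        refine (h2.trans hreach).trans ?_
        rw [hq1] at hq2
        exact hq2.symm)
  le_refl := by
    refine Quotient.ind (fun p => ?_)
    exact ⟨subset_rfl, SimpleGraph.Reachable.refl _⟩
  le_trans := by
    refine Quotient.ind fun p => Quotient.ind fun q => Quotient.ind fun u => ?_
    rintro ⟨h1, h2⟩ ⟨h3, h4⟩
    exact ⟨h1.trans h3, (cEquiv_mono G c h3 h2).trans h4⟩
  le_antisymm := by
    refine Quotient.ind fun p => Quotient.ind fun q => ?_
    rintro ⟨h1, h2⟩ ⟨h3, h4⟩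
    exact Quotient.sound ⟨subset_antisymm h1 h3, subset_antisymm h3 h1 ▸ h2⟩

/-- The rank of a face of `P_G`. -/
def faceRank (G : SimpleGraph V) (c : V → V → R) : ColorfulFace G c → ℕ :=
  Quotient.lift (fun p => p.1.card) (fun p q h => by
    show p.1.card = q.1.card
    rw [(h.1 : p.1 = q.1)])

lemma cEquiv_of_adj {G : SimpleGraph V} {c : V → V → R} {C : Finset R} {v w : V}
    (h : G.Adj v w) (hC : c v w ∈ C) : cEquiv G c C v w :=
  SimpleGraph.Adj.reachable ⟨h.ne, Or.inl ⟨h, hC⟩⟩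

/-- An equivalence class of `C`-equivalence contains every set of vertices that is closed under
edges with colors in `C` and meets it. -/
lemma cEquiv.mem_of_closed {G : SimpleGraph V} {c : V → V → R} (hc : IsProperColoring G c)
    {C : Finset R} {S : Set V} (hS : ∀ x ∈ S, ∀ y, G.Adj x y → c x y ∈ C → y ∈ S)
    {v w : V} (h : cEquiv G c C v w) (hv : v ∈ S) : w ∈ S := by
  obtain ⟨p⟩ := h
  induction p with
  | nil => exact hv
  | @cons x y _ hxy _ ih =>
    refine ih ?_
    rcases hxy.2 with ⟨hadj, hmem⟩ | ⟨hadj, hmem⟩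
    · exact hS x hv y hadj hmem
    · exact hS x hv y hadj.symm (hc.symm y x hadj ▸ hmem)

lemma cEquiv_empty_iff {G : SimpleGraph V} {c : V → V → R} (hc : IsProperColoring G c)
    {v w : V} : cEquiv G c ∅ v w ↔ v = w := by
  refine ⟨fun h => ?_, fun h => h ▸ SimpleGraph.Reachable.refl _⟩
  exact (h.mem_of_closed hc (S := {v}) (by simp) rfl).symm

lemma mkFace_eq_iff {G : SimpleGraph V} {c : V → V → R} {C D : Finset R} {v w : V} :
    mkFace G c C v = mkFace G c D w ↔ C = D ∧ cEquiv G c C v w :=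
  Quotient.eq (r := faceSetoid G c)

lemma mkFace_le_iff {G : SimpleGraph V} {c : V → V → R} {C D : Finset R} {v w : V} :
    mkFace G c C v ≤ mkFace G c D w ↔ C ⊆ D ∧ cEquiv G c D v w :=
  Iff.rfl

lemma exists_eq_mkFace {G : SimpleGraph V} {c : V → V → R} (K : ColorfulFace G c) :
    ∃ C v, K = mkFace G c C v := by
  induction K using Quotient.ind with
  | _ p => exact ⟨p.1, p.2, rfl⟩

lemma mkFace_lt_mkFace_iff {G : SimpleGraph V} {c : V → V → R} {C D : Finset R} {v : V} :
    mkFace G c C v < mkFace G c D v ↔ C ⊂ D := by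
  have h (E : Finset R) : cEquiv G c E v v := SimpleGraph.Reachable.refl _
  simp only [lt_iff_le_not_ge, mkFace_le_iff, h, and_true]

/-- Every face above `(C, v)` is represented by a pair with the same vertex `v`. -/
lemma exists_eq_mkFace_of_mkFace_le {G : SimpleGraph V} {c : V → V → R} {C : Finset R} {v : V}
    {K : ColorfulFace G c} (h : mkFace G c C v ≤ K) : ∃ E, K = mkFace G c E v := by
  obtain ⟨E, u, rfl⟩ := exists_eq_mkFace K
  exact ⟨E, mkFace_eq_iff.2 ⟨rfl, (mkFace_le_iff.1 h).2.symm⟩⟩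

lemma cEquiv_singleton_iff {G : SimpleGraph V} {c : V → V → R} (hc : IsProperColoring G c)
    {v w : V} (hvw : G.Adj v w) {u : V} :
    cEquiv G c {c v w} v u ↔ u = v ∨ u = w := by
  constructor
  · intro h
    refine h.mem_of_closed hc (S := {x | x = v ∨ x = w}) ?_ (Or.inl rfl)
    rintro x (rfl | rfl) y hy hcol
    · exact Or.inr ((hc.bijOn x).injOn hy hvw (Finset.mem_singleton.1 hcol))
    · exact Or.inl ((hc.bijOn x).injOn hy hvw.symm
        ((Finset.mem_singleton.1 hcol).trans (hc.symm _ _ hvw)))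
  · rintro (rfl | rfl)
    · exact SimpleGraph.Reachable.refl _
    · exact cEquiv_of_adj hvw (Finset.mem_singleton_self _)

lemma setOf_vertices_le_edge {G : SimpleGraph V} {c : V → V → R} (hc : IsProperColoring G c)
    {v w : V} (hvw : G.Adj v w) :
    {x : ColorfulFace G c | faceRank G c x = 0 ∧ x ≤ mkFace G c {c v w} v} =
      {mkFace G c ∅ v, mkFace G c ∅ w} := by
  ext x
  obtain ⟨E, u, rfl⟩ := exists_eq_mkFace x
  have hrank : faceRank G c (mkFace G c E u) = 0 ↔ E = ∅ := Finset.card_eq_zero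
  simp only [Set.mem_ofPred_eq, Set.mem_insert_iff, Set.mem_singleton_iff, hrank, mkFace_le_iff,
    mkFace_eq_iff]
  have hsymm : cEquiv G c {c v w} u v ↔ cEquiv G c {c v w} v u :=
    ⟨SimpleGraph.Reachable.symm, SimpleGraph.Reachable.symm⟩
  rw [hsymm, cEquiv_singleton_iff hc hvw, ← and_or_left]
  refine and_congr_right ?_
  rintro rfl
  simp [cEquiv_empty_iff hc]

lemma setOf_mkFace_lt_lt {G : SimpleGraph V} {c : V → V → R} (C D : Finset R) (v : V) :
    {K : ColorfulFace G c | mkFace G c C v < K ∧ K < mkFace G c D v} =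
      (fun E => mkFace G c E v) '' Set.Ioo C D := by
  ext K
  constructor
  · rintro ⟨h₁, h₂⟩
    obtain ⟨E, rfl⟩ := exists_eq_mkFace_of_mkFace_le h₁.le
    exact ⟨E, ⟨mkFace_lt_mkFace_iff.1 h₁, mkFace_lt_mkFace_iff.1 h₂⟩, rfl⟩
  · rintro ⟨E, ⟨h₁, h₂⟩, rfl⟩
    exact ⟨mkFace_lt_mkFace_iff.2 h₁, mkFace_lt_mkFace_iff.2 h₂⟩

/-- The Boolean lattice satisfies the diamond condition. -/
lemma Finset.exists_Ioo_eq_pair_of_card_eq_add_two {α : Type*} [DecidableEq α] {C D : Finset α}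
    (hCD : C ⊆ D) (hcard : D.card = C.card + 2) :
    ∃ E₁ E₂ : Finset α, E₁ ≠ E₂ ∧ Set.Ioo C D = {E₁, E₂} := by
  obtain ⟨a, b, hab, hD⟩ : ∃ a b, a ≠ b ∧ D \ C = {a, b} := by
    rw [← Finset.card_eq_two, Finset.card_sdiff_of_subset hCD]
    omega
  have hmem (x : α) : x ∈ D ∧ x ∉ C ↔ x = a ∨ x = b := by
    rw [← Finset.mem_sdiff, hD, Finset.mem_insert, Finset.mem_singleton]
  have haD := (hmem a).2 (Or.inl rfl)
  have hbD := (hmem b).2 (Or.inr rfl)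
  refine ⟨insert a C, insert b C, fun h => ?_, ?_⟩
  · have := h ▸ Finset.mem_insert_self a C
    simp [hab, haD.2] at this
  ext E
  simp only [Set.mem_Ioo, Set.mem_insert_iff, Set.mem_singleton_iff]
  constructor
  · rintro ⟨hCE, hED⟩
    have hE : E.card = C.card + 1 := by
      have := Finset.card_lt_card hCE
      have := Finset.card_lt_card hED
      omega
    obtain ⟨x, hxE, hxC⟩ := Finset.exists_of_ssubset hCE
    have hEx : insert x C = E := Finset.eq_of_subset_of_card_le
      (Finset.insert_subset hxE hCE.subset) (by rw [hE, Finset.card_insert_of_notMem hxC])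
    rcases (hmem x).1 ⟨hED.subset hxE, hxC⟩ with rfl | rfl
    · exact Or.inl hEx.symm
    · exact Or.inr hEx.symm
  · have key {x : α} (hx : x ∈ D ∧ x ∉ C) : C ⊂ insert x C ∧ insert x C ⊂ D := by
      refine ⟨Finset.ssubset_insert hx.2, (Finset.insert_subset hx.1 hCD).ssubset_of_ne ?_⟩
      rintro rfl
      rw [Finset.card_insert_of_notMem hx.2] at hcard
      omega
    rintro (rfl | rfl)
    · exact key haD
    · exact key hbD

/-- the diamond condition for `P_G`. (i) A rank-1 face `({a},v)` lies above
exactly two rank-0 faces, namely `(∅,v)` and `(∅,w)` where `w` is the unique vertex joined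
to `v` by the edge of color `a` at `v`. (ii) If `F = (C,v)` and `H = (D,v)` with `C ⊆ D`
and `|D| = |C| + 2`, then there are exactly two faces `K` with `F < K < H`. -/
theorem colorful_diamond_condition
    {V R : Type*} [Fintype V] [Fintype R] [DecidableEq R]
    (G : SimpleGraph V) (hconn : G.Connected) (c : V → V → R)
    (hc : IsProperColoring G c) :
    (∀ (a : R) (v : V), ∃ w : V,
      G.Adj v w ∧ c v w = a ∧ (∀ w' : V, G.Adj v w' → c v w' = a → w' = w) ∧
      mkFace G c ∅ v ≠ mkFace G c ∅ w ∧
      {x : ColorfulFace G c | faceRank G c x = 0 ∧ x ≤ mkFace G c {a} v} =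
        {mkFace G c ∅ v, mkFace G c ∅ w}) ∧
    (∀ (C D : Finset R) (v : V), C ⊆ D → D.card = C.card + 2 →
      ∃ K₁ K₂ : ColorfulFace G c, K₁ ≠ K₂ ∧
        {K : ColorfulFace G c | mkFace G c C v < K ∧ K < mkFace G c D v} = {K₁, K₂}) := by
  refine ⟨fun a v => ?_, fun C D v hCD hcard => ?_⟩
  · obtain ⟨w, hvw, rfl⟩ := (hc.bijOn v).surjOn (Set.mem_univ a)
    refine ⟨w, hvw, rfl, fun w' hw' h => (hc.bijOn v).injOn hw' hvw h, fun h => ?_,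
      setOf_vertices_le_edge hc hvw⟩
    exact G.ne_of_adj hvw ((cEquiv_empty_iff hc).1 (mkFace_eq_iff.1 h).2)
  · obtain ⟨E₁, E₂, hne, hE⟩ := Finset.exists_Ioo_eq_pair_of_card_eq_add_two hCD hcard
    refine ⟨mkFace G c E₁ v, mkFace G c E₂ v, fun h => hne (mkFace_eq_iff.1 h).1, ?_⟩
    rw [setOf_mkFace_lt_lt, hE, Set.image_pair]
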